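/- arXiv:1405.5454 — 4 statements merged into one kernel-verified Lean document; each statement's English description precedes it below -/
import Mathlib

section
/- Let h : Δ(2,3,8) → ℤ/2ℤ be the group homomorphism determined by h(x) = 1 and h(y) = 0. Then ker(h) equals the subgroup of Δ(2,3,8) generated by y and xyx, and the assignment a ↦ y, b ↦ xyx extends to a group isomorphism from Δ(3,3,4) onto ker(h). -/
set_option synthInstance.maxHeartbeats 1000000
set_option maxHeartbeats 1000000
set_option linter.unusedVariables false
noncomputable section
open Quaternion

/-- The relations of the `(2,3,8)` triangle group `⟨x, y ∣ x² = y³ = (xy)⁸ = 1⟩`. -/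
def rels238 : Set (FreeGroup (Fin 2)) :=
  {FreeGroup.of 0 ^ 2, FreeGroup.of 1 ^ 3, (FreeGroup.of 0 * FreeGroup.of 1) ^ 8}

/-- The `(2,3,8)` triangle group. -/
abbrev Δ238 : Type := PresentedGroup rels238

/-- The generator `x` of `Δ(2,3,8)`. -/
def xΔ : Δ238 := PresentedGroup.of 0

/-- The generator `y` of `Δ(2,3,8)`. -/
def yΔ : Δ238 := PresentedGroup.of 1

/-- The relations of the `(3,3,4)` triangle group `⟨a, b ∣ a³ = b³ = (ab)⁴ = 1⟩`. -/
def rels334 : Set (FreeGroup (Fin 2)) :=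
  {FreeGroup.of 0 ^ 3, FreeGroup.of 1 ^ 3, (FreeGroup.of 0 * FreeGroup.of 1) ^ 4}

/-- The `(3,3,4)` triangle group. -/
abbrev Δ334 : Type := PresentedGroup rels334

/-- The generator `a` of `Δ(3,3,4)`. -/
def aΔ : Δ334 := PresentedGroup.of 0

/-- The generator `b` of `Δ(3,3,4)`. -/
def bΔ : Δ334 := PresentedGroup.of 1


lemma aΔ_pow : aΔ ^ 3 = 1 := by
  have : PresentedGroup.mk rels334 (FreeGroup.of 0 ^ 3) = 1 :=
    PresentedGroup.one_of_mem (by simp [rels334])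
  simp only [map_pow, map_mul] at this
  exact this

lemma bΔ_pow : bΔ ^ 3 = 1 := by
  have : PresentedGroup.mk rels334 (FreeGroup.of 1 ^ 3) = 1 :=
    PresentedGroup.one_of_mem (by simp [rels334])
  simp only [map_pow, map_mul] at this
  exact this

lemma abΔ_pow : (aΔ * bΔ) ^ 4 = 1 := by
  have : PresentedGroup.mk rels334 ((FreeGroup.of 0 * FreeGroup.of 1) ^ 4) = 1 :=
    PresentedGroup.one_of_mem (by simp [rels334])
  simp only [map_pow, map_mul] at this
  exact this

lemma baΔ_pow : (bΔ * aΔ) ^ 4 = 1 := by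
  have e : bΔ * aΔ = aΔ⁻¹ * (aΔ * bΔ) * aΔ⁻¹⁻¹ := by group
  rw [e, conj_pow, abΔ_pow]; group

lemma xΔ_pow : xΔ ^ 2 = 1 := by
  have : PresentedGroup.mk rels238 (FreeGroup.of 0 ^ 2) = 1 :=
    PresentedGroup.one_of_mem (by simp [rels238])
  simp only [map_pow, map_mul] at this
  exact this

lemma yΔ_pow : yΔ ^ 3 = 1 := by
  have : PresentedGroup.mk rels238 (FreeGroup.of 1 ^ 3) = 1 :=
    PresentedGroup.one_of_mem (by simp [rels238])
  simp only [map_pow, map_mul] at this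
  exact this

lemma xyΔ_pow : (xΔ * yΔ) ^ 8 = 1 := by
  have : PresentedGroup.mk rels238 ((FreeGroup.of 0 * FreeGroup.of 1) ^ 8) = 1 :=
    PresentedGroup.one_of_mem (by simp [rels238])
  simp only [map_pow, map_mul] at this
  exact this

lemma xxΔ : xΔ * xΔ = 1 := by rw [← pow_two, xΔ_pow]

lemma xΔ_inv : xΔ⁻¹ = xΔ := inv_eq_of_mul_eq_one_left xxΔ

/-- Universal property of `Δ(3,3,4)`. -/
def lift334 {G : Type*} [Group G] (u v : G) (hu : u ^ 3 = 1) (hv : v ^ 3 = 1)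
    (huv : (u * v) ^ 4 = 1) : Δ334 →* G :=
  PresentedGroup.toGroup (f := ![u, v]) (by
    intro r hr
    rcases hr with rfl | rfl | rfl <;> simpa)

lemma lift334_a {G : Type*} [Group G] (u v : G) (hu : u ^ 3 = 1) (hv : v ^ 3 = 1)
    (huv : (u * v) ^ 4 = 1) : lift334 u v hu hv huv aΔ = u := by
  simp [lift334, aΔ]

lemma lift334_b {G : Type*} [Group G] (u v : G) (hu : u ^ 3 = 1) (hv : v ^ 3 = 1)
    (huv : (u * v) ^ 4 = 1) : lift334 u v hu hv huv bΔ = v := by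
  simp [lift334, bΔ]

/-- Universal property of `Δ(2,3,8)`. -/
def lift238 {G : Type*} [Group G] (u v : G) (hu : u ^ 2 = 1) (hv : v ^ 3 = 1)
    (huv : (u * v) ^ 8 = 1) : Δ238 →* G :=
  PresentedGroup.toGroup (f := ![u, v]) (by
    intro r hr
    rcases hr with rfl | rfl | rfl <;> simpa)

lemma lift238_x {G : Type*} [Group G] (u v : G) (hu : u ^ 2 = 1) (hv : v ^ 3 = 1)
    (huv : (u * v) ^ 8 = 1) : lift238 u v hu hv huv xΔ = u := by
  simp [lift238, xΔ]

lemma lift238_y {G : Type*} [Group G] (u v : G) (hu : u ^ 2 = 1) (hv : v ^ 3 = 1)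
    (huv : (u * v) ^ 8 = 1) : lift238 u v hu hv huv yΔ = v := by
  simp [lift238, yΔ]

lemma hom334_ext {G : Type*} [Group G] (f g : Δ334 →* G) (ha : f aΔ = g aΔ)
    (hb : f bΔ = g bΔ) : f = g := by
  apply PresentedGroup.ext
  intro i
  fin_cases i
  · exact ha
  · exact hb

/-- The swap endomorphism of `Δ(3,3,4)`. -/
def swapHom : Δ334 →* Δ334 := lift334 bΔ aΔ bΔ_pow aΔ_pow baΔ_pow

lemma swapHom_a : swapHom aΔ = bΔ := lift334_a _ _ _ _ _
lemma swapHom_b : swapHom bΔ = aΔ := lift334_b _ _ _ _ _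

lemma swapHom_comp : swapHom.comp swapHom = MonoidHom.id _ :=
  hom334_ext _ _ (by simp [swapHom_a, swapHom_b]) (by simp [swapHom_a, swapHom_b])

/-- The swap automorphism of `Δ(3,3,4)`. -/
def swapAut : MulAut Δ334 := MonoidHom.toMulEquiv swapHom swapHom swapHom_comp swapHom_comp

lemma swapAut_apply (g : Δ334) : swapAut g = swapHom g := rfl

lemma swapAut_sq : swapAut * swapAut = 1 := by
  ext g
  exact DFunLike.congr_fun swapHom_comp g

/-- The holomorph of `Δ(3,3,4)`. -/
abbrev Hol : Type := Δ334 ⋊[MonoidHom.id (MulAut Δ334)] MulAut Δ334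

/-- The image of `x`. -/
def xH : Hol := SemidirectProduct.inr swapAut
/-- The image of `y`. -/
def yH : Hol := SemidirectProduct.inl aΔ

lemma xH_sq : xH * xH = 1 := by
  rw [xH, ← map_mul, swapAut_sq, map_one]

lemma xyxH : xH * yH * xH = SemidirectProduct.inl bΔ := by
  have h1 : xH⁻¹ = xH := inv_eq_of_mul_eq_one_left xH_sq
  have h2 := SemidirectProduct.inl_aut (φ := MonoidHom.id (MulAut Δ334)) swapAut aΔ
  simp only [MonoidHom.id_apply, swapAut_apply, swapHom_a, map_inv] at h2
  rw [h2]
  change _ = xH * yH * xH⁻¹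
  rw [h1]

/-- The map from `Δ(2,3,8)` to the holomorph. -/
def toHol : Δ238 →* Hol := lift238 xH yH (by rw [pow_two, xH_sq])
  (by rw [yH, ← map_pow, aΔ_pow, map_one])
  (by
    have : (xH * yH) ^ 2 = SemidirectProduct.inl (bΔ * aΔ) := by
      rw [map_mul, ← xyxH, pow_two]; simp only [yH, mul_assoc]
    rw [show 8 = 2 * 4 from rfl, pow_mul, this, ← map_pow, baΔ_pow, map_one])

/-- The map `a ↦ y`, `b ↦ xyx`. -/
def toΔ238 : Δ334 →* Δ238 := lift334 yΔ (xΔ * yΔ * xΔ) yΔ_pow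
  (by
    have e : xΔ * yΔ * xΔ = xΔ * yΔ * xΔ⁻¹ := by rw [xΔ_inv]
    rw [e, conj_pow, yΔ_pow]; group)
  (by
    have e : yΔ * (xΔ * yΔ * xΔ) = xΔ⁻¹ * (xΔ * yΔ) ^ 2 * xΔ⁻¹⁻¹ := by
      rw [inv_inv, pow_two]
      simp only [mul_assoc, inv_mul_cancel_left]
    rw [e, conj_pow, ← pow_mul, xyΔ_pow]; group)

lemma toΔ238_a : toΔ238 aΔ = yΔ := lift334_a _ _ _ _ _
lemma toΔ238_b : toΔ238 bΔ = xΔ * yΔ * xΔ := lift334_b _ _ _ _ _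
lemma toHol_x : toHol xΔ = xH := lift238_x _ _ _ _ _
lemma toHol_y : toHol yΔ = yH := lift238_y _ _ _ _ _

lemma toHol_comp : toHol.comp toΔ238 = SemidirectProduct.inl :=
  hom334_ext _ _ (by simp [toΔ238_a, toHol_y, yH])
    (by simp only [MonoidHom.comp_apply, toΔ238_b, map_mul, toHol_x, toHol_y, xyxH])

lemma toΔ238_injective : Function.Injective toΔ238 := by
  have h1 : Function.Injective (toHol.comp toΔ238) := by
    rw [toHol_comp]; exact SemidirectProduct.inl_injective
  exact Function.Injective.of_comp (f := toHol) h1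

lemma mem_range_or (g : Δ238) : g ∈ toΔ238.range ∨ g * xΔ ∈ toΔ238.range := by
  have hy : yΔ ∈ toΔ238.range := ⟨aΔ, toΔ238_a⟩
  have hxyx : xΔ * yΔ * xΔ ∈ toΔ238.range := ⟨bΔ, toΔ238_b⟩
  have key : ∀ g : Δ238, (g ∈ toΔ238.range ∨ g * xΔ ∈ toΔ238.range) →
      (g * xΔ ∈ toΔ238.range ∨ g * xΔ * xΔ ∈ toΔ238.range) := by
    intro g hg
    rw [mul_assoc g, xxΔ, mul_one]; exact hg.symm
  have keyy : ∀ g : Δ238, (g ∈ toΔ238.range ∨ g * xΔ ∈ toΔ238.range) →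
      (g * yΔ ∈ toΔ238.range ∨ g * yΔ * xΔ ∈ toΔ238.range) := by
    rintro g (hg | hg)
    · exact Or.inl (mul_mem hg hy)
    · right
      have := mul_mem hg hxyx
      rwa [show g * xΔ * (xΔ * yΔ * xΔ) = g * (xΔ * xΔ) * yΔ * xΔ by group, xxΔ,
        mul_one] at this
  have hg : g ∈ Subgroup.closure (Set.range (PresentedGroup.of (rels := rels238))) := by
    rw [PresentedGroup.closure_range_of]; trivial
  induction hg using Subgroup.closure_induction_right with
  | one => exact Or.inl (one_mem _)
  | mul_right g s hg hs ih =>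
    obtain ⟨i, rfl⟩ := hs
    fin_cases i
    · exact key g ih
    · exact keyy g ih
  | mul_inv_cancel g s hg hs ih =>
    obtain ⟨i, rfl⟩ := hs
    fin_cases i
    · change g * xΔ⁻¹ ∈ _ ∨ g * xΔ⁻¹ * xΔ ∈ _
      rw [xΔ_inv]; exact key g ih
    · change g * yΔ⁻¹ ∈ _ ∨ g * yΔ⁻¹ * xΔ ∈ _
      have e : yΔ⁻¹ = yΔ * yΔ := by
        apply inv_eq_of_mul_eq_one_left
        rw [← yΔ_pow, pow_succ, pow_two]
      rw [e, ← mul_assoc]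
      exact keyy _ (keyy _ ih)

lemma range_eq_closure : toΔ238.range = Subgroup.closure {yΔ, xΔ * yΔ * xΔ} := by
  rw [MonoidHom.range_eq_map, ← PresentedGroup.closure_range_of, MonoidHom.map_closure]
  congr 1
  rw [← Set.range_comp]
  ext g
  simp only [Set.mem_range, Function.comp, Fin.exists_fin_two, Set.mem_insert_iff,
    Set.mem_singleton_iff]
  change toΔ238 aΔ = g ∨ toΔ238 bΔ = g ↔ _
  rw [toΔ238_a, toΔ238_b, eq_comm, eq_comm (a := xΔ * yΔ * xΔ)]

lemma ker_eq_range (h : Δ238 →* Multiplicative (ZMod 2))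
    (hx : h xΔ = Multiplicative.ofAdd 1) (hy : h yΔ = Multiplicative.ofAdd 0) :
    toΔ238.range = h.ker := by
  have hle : toΔ238.range ≤ h.ker := by
    rw [range_eq_closure, Subgroup.closure_le]
    rintro g (rfl | rfl)
    · exact hy
    · change h _ = 1
      rw [map_mul, map_mul, hx, hy]; decide
  refine le_antisymm hle fun g hg => ?_
  rcases mem_range_or g with h1 | h1
  · exact h1
  · have h2 : h (g * xΔ) = 1 := hle h1
    rw [map_mul, MonoidHom.mem_ker.1 hg, hx] at h2
    exact absurd h2 (by decide)

/-- Let `h : Δ(2,3,8) → ℤ/2ℤ` be the homomorphism with `h(x) = 1`, `h(y) = 0`.  Then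
`ker h` is the subgroup generated by `y` and `xyx`, and `a ↦ y`, `b ↦ xyx` extends to a
group isomorphism of `Δ(3,3,4)` onto `ker h`. -/
theorem stmt_0 (h : Δ238 →* Multiplicative (ZMod 2))
    (hx : h xΔ = Multiplicative.ofAdd 1) (hy : h yΔ = Multiplicative.ofAdd 0) :
    h.ker = Subgroup.closure {yΔ, xΔ * yΔ * xΔ} ∧
    ∃ ψ : Δ334 ≃* ↥h.ker,
      ((ψ aΔ : ↥h.ker) : Δ238) = yΔ ∧ ((ψ bΔ : ↥h.ker) : Δ238) = xΔ * yΔ * xΔ := by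
  have hk := ker_eq_range h hx hy
  refine ⟨by rw [← hk, range_eq_closure], ?_⟩
  refine ⟨(MonoidHom.ofInjective toΔ238_injective).trans (MulEquiv.subgroupCongr hk), ?_, ?_⟩
  · exact toΔ238_a
  · exact toΔ238_b
end
end

section
/- The quaternion algebra D_B is a division ring: every nonzero element of D_B is invertible. -/
set_option synthInstance.maxHeartbeats 1000000
set_option maxHeartbeats 1000000
set_option linter.unusedVariables false
noncomputable section
open Quaternion

/-- `K = ℚ(√2)`, the subfield of `ℝ` generated (over its prime field `ℚ`) by `√2`. -/
def Ksub : Subfield ℝ := Subfield.closure {Real.sqrt 2}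

abbrev K : Type := ↥Ksub

/-- `√2` as an element of `K`. -/
def r2 : K := ⟨Real.sqrt 2, Subfield.subset_closure rfl⟩

/-- The quaternion algebra `D_B = (-3, √2)` over `K`, with `i² = -3`, `j² = √2`, `ji = -ij`. -/
abbrev D : Type := ℍ[K, -3, r2]

/-- `O_K = ℤ[√2]`, the ring of integers of `K`, i.e. the subring of `K` generated by `√2`. -/
def OK : Subring K := Subring.closure {r2}

/-- `√2` as an element of `O_K`. -/
def r2OK : ↥OK := ⟨r2, Subring.subset_closure rfl⟩

/-- The quaternion unit `i` of `D_B`. -/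
def iD : D := ⟨0, 1, 0, 0⟩

/-- The quaternion unit `j` of `D_B`. -/
def jD : D := ⟨0, 0, 1, 0⟩

/-- `α = (1/2)(1 + i)`. -/
def αD : D := (2 : K)⁻¹ • (1 + iD : D)

/-- `β = (1/6)(3 + (1 + 2√2) i − 2 i j)`. -/
def βD : D := (6 : K)⁻¹ • ((3 : K) • (1 : D) + (1 + 2 * r2 : K) • iD - (2 : K) • (iD * jD) : D)

/-- `γ = (1/6)(3 + i)(1 − (1 + √2) j)`. -/
def γD : D := (6 : K)⁻¹ • (((3 : K) • (1 : D) + iD) * (1 - (1 + r2 : K) • jD) : D)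

/-- `γ' = (1/6)(3 + i)(1 + (1 + √2) j)`. -/
def γ'D : D := (6 : K)⁻¹ • (((3 : K) • (1 : D) + iD) * (1 + (1 + r2 : K) • jD) : D)

/-- The reduced trace `Tr(x) = x + x* = 2x₀` of a quaternion, as an element of `K`. -/
def Trd (x : D) : K := 2 * x.re

/-- The reduced norm `N(x) = x·x*` of a quaternion, as an element of `K`. -/
def Nrd (x : D) : K := (x * star x).re

/-- Every element of `K` is `a + b √2` with `a`, `b` rational. -/
lemma K_rep (x : K) : ∃ a b : ℚ, (x : ℝ) = a + b * Real.sqrt 2 := by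
  have h2 : Real.sqrt 2 * Real.sqrt 2 = 2 := Real.mul_self_sqrt (by norm_num)
  obtain ⟨x, hx⟩ := x
  show ∃ a b : ℚ, x = a + b * Real.sqrt 2
  change x ∈ Subfield.closure {Real.sqrt 2} at hx
  induction hx using Subfield.closure_induction with
  | mem x hx => exact ⟨0, 1, by simpa using hx⟩
  | one => exact ⟨1, 0, by simp⟩
  | add x y _ _ hx hy =>
    obtain ⟨a, b, rfl⟩ := hx
    obtain ⟨c, d, rfl⟩ := hy
    exact ⟨a + c, b + d, by push_cast; ring⟩
  | neg x _ hx =>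
    obtain ⟨a, b, rfl⟩ := hx
    exact ⟨-a, -b, by push_cast; ring⟩
  | mul x y _ _ hx hy =>
    obtain ⟨a, b, rfl⟩ := hx
    obtain ⟨c, d, rfl⟩ := hy
    exact ⟨a * c + 2 * b * d, a * d + b * c, by
      push_cast; linear_combination (b * d : ℝ) * h2⟩
  | inv x _ hx =>
    obtain ⟨a, b, rfl⟩ := hx
    by_cases hz : (a + b * Real.sqrt 2 : ℝ) = 0
    · exact ⟨0, 0, by simp [hz]⟩
    have hn : (a ^ 2 - 2 * b ^ 2 : ℝ) ≠ 0 := by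
      intro h0
      have h3 : (a + b * Real.sqrt 2 : ℝ) * (a - b * Real.sqrt 2) = 0 := by
        linear_combination h0 - (b ^ 2 : ℝ) * h2
      have h4 := (mul_eq_zero.mp h3).resolve_left hz
      have hb : b = 0 := by
        by_contra hb
        have hb' : (b : ℝ) ≠ 0 := by exact_mod_cast hb
        apply irrational_sqrt_two
        refine ⟨a / b, ?_⟩
        push_cast
        field_simp
        linarith
      apply hz
      subst hb
      simpa using h4
    refine ⟨a / (a ^ 2 - 2 * b ^ 2), -b / (a ^ 2 - 2 * b ^ 2), ?_⟩
    apply inv_eq_of_mul_eq_one_right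
    push_cast
    have hm := mul_inv_cancel₀ hn
    rw [div_eq_mul_inv, div_eq_mul_inv]
    generalize ((a : ℝ) ^ 2 - 2 * (b : ℝ) ^ 2)⁻¹ = m at hm ⊢
    linear_combination hm - (b ^ 2 * m : ℝ) * h2

lemma rat_sqrt_two (a b : ℚ) (h : (a + b * Real.sqrt 2 : ℝ) = 0) : a = 0 ∧ b = 0 := by
  have hb : b = 0 := by
    by_contra hb
    have hb' : (b : ℝ) ≠ 0 := by exact_mod_cast hb
    apply irrational_sqrt_two
    refine ⟨-a / b, ?_⟩
    push_cast
    field_simp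
    linarith
  subst hb
  exact ⟨by simpa using h, rfl⟩

/-- The norm form is anisotropic: its conjugate under `√2 ↦ -√2` is positive definite. -/
lemma norm_aniso (x y z w : K) (h : x ^ 2 + 3 * y ^ 2 - r2 * (z ^ 2 + 3 * w ^ 2) = 0) :
    x = 0 ∧ y = 0 ∧ z = 0 ∧ w = 0 := by
  have h2 : Real.sqrt 2 * Real.sqrt 2 = 2 := Real.mul_self_sqrt (by norm_num)
  have hs : 0 < Real.sqrt 2 := by positivity
  have hR : (x : ℝ) ^ 2 + 3 * (y : ℝ) ^ 2 - Real.sqrt 2 * ((z : ℝ) ^ 2 + 3 * (w : ℝ) ^ 2) = 0 :=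
    congrArg (Subtype.val : K → ℝ) h
  obtain ⟨a, a', hx⟩ := K_rep x
  obtain ⟨b, b', hy⟩ := K_rep y
  obtain ⟨c, c', hz⟩ := K_rep z
  obtain ⟨d, d', hw⟩ := K_rep w
  rw [hx, hy, hz, hw] at hR
  obtain ⟨hP, hQ⟩ := rat_sqrt_two
    (a ^ 2 + 2 * a' ^ 2 + 3 * (b ^ 2 + 2 * b' ^ 2) - 4 * (c * c' + 3 * d * d'))
    (2 * a * a' + 6 * b * b' - (c ^ 2 + 2 * c' ^ 2 + 3 * (d ^ 2 + 2 * d' ^ 2))) (by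
      push_cast
      linear_combination hR + (-(a' : ℝ) ^ 2 - 3 * b' ^ 2 + 2 * (c * c' + 3 * d * d')
        + Real.sqrt 2 * (c' ^ 2 + 3 * d' ^ 2)) * h2)
  have hP' : (a ^ 2 + 2 * a' ^ 2 + 3 * (b ^ 2 + 2 * b' ^ 2) - 4 * (c * c' + 3 * d * d') : ℝ) = 0 := by
    exact_mod_cast hP
  have hQ' : (2 * a * a' + 6 * b * b' - (c ^ 2 + 2 * c' ^ 2 + 3 * (d ^ 2 + 2 * d' ^ 2)) : ℝ) = 0 := by
    exact_mod_cast hQ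
  have key : (a - a' * Real.sqrt 2 : ℝ) ^ 2 + 3 * (b - b' * Real.sqrt 2 : ℝ) ^ 2
      + Real.sqrt 2 * (c - c' * Real.sqrt 2 : ℝ) ^ 2
      + 3 * (Real.sqrt 2 * (d - d' * Real.sqrt 2 : ℝ) ^ 2) = 0 := by
    linear_combination hP' - Real.sqrt 2 * hQ' + ((a' : ℝ) ^ 2 + 3 * b' ^ 2
      - 2 * (c * c' + 3 * d * d') + Real.sqrt 2 * (c' ^ 2 + 3 * d' ^ 2)) * h2
  have p1 := sq_nonneg (a - a' * Real.sqrt 2 : ℝ)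
  have p2 := sq_nonneg (b - b' * Real.sqrt 2 : ℝ)
  have p3 := mul_nonneg hs.le (sq_nonneg (c - c' * Real.sqrt 2 : ℝ))
  have p4 := mul_nonneg hs.le (sq_nonneg (d - d' * Real.sqrt 2 : ℝ))
  have fin : ∀ (t : K) (u v : ℚ), (t : ℝ) = u + v * Real.sqrt 2 →
      (u - v * Real.sqrt 2 : ℝ) ^ 2 = 0 → t = 0 := by
    intro t u v ht h0
    have h1 := pow_eq_zero_iff (two_ne_zero) |>.mp h0
    obtain ⟨hu, hv⟩ := rat_sqrt_two u (-v) (by push_cast; linarith)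
    have hv' : v = 0 := by linarith
    apply Subtype.ext
    rw [ht, hu, hv']
    simp
  refine ⟨fin x a a' hx (by linarith), fin y b b' hy (by linarith), fin z c c' hz ?_,
    fin w d d' hw ?_⟩
  · exact (mul_eq_zero.mp (by linarith :
      Real.sqrt 2 * (c - c' * Real.sqrt 2 : ℝ) ^ 2 = 0)).resolve_left hs.ne'
  · exact (mul_eq_zero.mp (by linarith :
      Real.sqrt 2 * (d - d' * Real.sqrt 2 : ℝ) ^ 2 = 0)).resolve_left hs.ne'

/-- The quaternion algebra `D_B` is a division ring: every nonzero element is invertible. -/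
theorem stmt_3 : ∀ x : D, x ≠ 0 → IsUnit x := by
  intro x hx
  obtain ⟨p, q, r, t⟩ := x
  have hN : p ^ 2 + 3 * q ^ 2 - r2 * (r ^ 2 + 3 * t ^ 2) ≠ 0 := by
    intro h
    obtain ⟨rfl, rfl, rfl, rfl⟩ := norm_aniso p q r t h
    exact hx rfl
  generalize hn : p ^ 2 + 3 * q ^ 2 - r2 * (r ^ 2 + 3 * t ^ 2) = n at hN
  have hm : n * n⁻¹ = 1 := mul_inv_cancel₀ hN
  generalize n⁻¹ = m at hm
  refine ⟨⟨⟨p, q, r, t⟩, ⟨m * p, -(m * q), -(m * r), -(m * t)⟩, ?_, ?_⟩, rfl⟩ <;>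
  · apply QuaternionAlgebra.ext <;> simp only [QuaternionAlgebra.mk_mul_mk, QuaternionAlgebra.re_one,
      QuaternionAlgebra.imI_one, QuaternionAlgebra.imJ_one, QuaternionAlgebra.imK_one] <;>
    first
    | ring1
    | linear_combination hm + m * hn
end
end

section
/- In the quaternion algebra D_B, the elements α and β have reduced norm 1 and satisfy α³ = β³ = (αβ)⁴ = -1. -/
set_option synthInstance.maxHeartbeats 1000000
set_option maxHeartbeats 1000000
set_option linter.unusedVariables false
noncomputable section
open Quaternion

theorem r2_sq : r2 * r2 = 2 := by
  apply Subtype.ext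
  change Real.sqrt 2 * Real.sqrt 2 = ((2 : K) : ℝ)
  rw [Real.mul_self_sqrt (by norm_num)]
  rfl

theorem αD_eq : αD = (⟨1 / 2, 1 / 2, 0, 0⟩ : D) := by
  unfold αD iD
  apply QuaternionAlgebra.ext <;> simp

theorem βD_eq : βD = (⟨1 / 2, (1 + 2 * r2) / 6, 0, -(1 / 3)⟩ : D) := by
  unfold βD iD jD
  apply QuaternionAlgebra.ext <;> simp <;> grind

theorem αβ_eq : αD * βD =
    (⟨-r2 / 2, (2 + r2) / 6, 1 / 2, -(1 / 6)⟩ : D) := by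
  rw [αD_eq, βD_eq]
  apply QuaternionAlgebra.ext <;> simp <;> grind

theorem αβ_sq : (αD * βD) * (αD * βD) =
    (⟨0, -(r2 + 1) / 3, -r2 / 2, r2 / 6⟩ : D) := by
  rw [αβ_eq]
  have h := r2_sq
  apply QuaternionAlgebra.ext <;> simp <;> grind

theorem βD_sq : βD * βD = (⟨-(1 / 2), (1 + 2 * r2) / 6, 0, -(1 / 3)⟩ : D) := by
  rw [βD_eq]
  have h := r2_sq
  apply QuaternionAlgebra.ext <;> simp <;> grind

/-- In `D_B`, the elements `α` and `β` have reduced norm `1` and satisfy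
`α³ = β³ = (αβ)⁴ = -1`. -/
theorem stmt_8 :
    Nrd αD = 1 ∧ Nrd βD = 1 ∧
    αD ^ 3 = -1 ∧ βD ^ 3 = -1 ∧ (αD * βD) ^ 4 = -1 := by
  have h := r2_sq
  refine ⟨?_, ?_, ?_, ?_, ?_⟩
  · rw [Nrd, αD_eq]; simp; grind
  · rw [Nrd, βD_eq]; simp; grind
  · rw [pow_succ, pow_two, αD_eq]
    apply QuaternionAlgebra.ext <;> simp <;> grind
  · rw [pow_succ, pow_two, βD_sq, βD_eq]
    apply QuaternionAlgebra.ext <;> simp <;> grind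
  · have e : (αD * βD) ^ 4 = ((αD * βD) * (αD * βD)) * ((αD * βD) * (αD * βD)) := by
      rw [← pow_two, ← pow_two, ← pow_mul]
    rw [e, αβ_sq]
    apply QuaternionAlgebra.ext <;> simp <;> grind
end
end

section
/- The group with presentation ⟨x, y | x² = y³ = (xy)⁸ = (yx)⁴(y⁻¹x)⁴ = 1⟩ is isomorphic to GL₂(F₃), the group of invertible 2×2 matrices over the field with 3 elements; an isomorphism is induced by sending x to the matrix [[0,1],[1,0]] and y to the matrix [[1,1],[0,1]]. -/
set_option synthInstance.maxHeartbeats 1000000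
set_option maxHeartbeats 1000000
set_option linter.unusedVariables false
noncomputable section
open Quaternion

open Matrix in
/-- The relations `x², y³, (xy)⁸, (yx)⁴(y⁻¹x)⁴`. -/
def relsB : Set (FreeGroup (Fin 2)) :=
  {FreeGroup.of 0 ^ 2, FreeGroup.of 1 ^ 3, (FreeGroup.of 0 * FreeGroup.of 1) ^ 8,
    (FreeGroup.of 1 * FreeGroup.of 0) ^ 4 * ((FreeGroup.of 1)⁻¹ * FreeGroup.of 0) ^ 4}

/-- The group `⟨x, y ∣ x² = y³ = (xy)⁸ = (yx)⁴(y⁻¹x)⁴ = 1⟩`. -/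
abbrev GB : Type := PresentedGroup relsB

open Matrix in
/-- The matrix `[[0,1],[1,0]]` as an element of `GL₂(F₃)`. -/
def Mx : GL (Fin 2) (ZMod 3) :=
  ⟨!![0, 1; 1, 0], !![0, 1; 1, 0], by decide, by decide⟩

open Matrix in
/-- The matrix `[[1,1],[0,1]]` as an element of `GL₂(F₃)`. -/
def My : GL (Fin 2) (ZMod 3) :=
  ⟨!![1, 1; 0, 1], !![1, -1; 0, 1], by decide, by decide⟩

theorem pow_mod_aux {G : Type*} [Group G] {a : G} (h : a ^ 8 = 1) (k : ℕ) :
    a ^ (k % 8) = a ^ k := by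
  conv_rhs => rw [← Nat.mod_add_div k 8, pow_add, pow_mul, h, one_pow, mul_one]

/-- Left coset representatives of the subgroup generated by `y * x`. -/
def cosetRep {G : Type*} [Group G] (x y : G) : Fin 6 → G :=
  ![1, y, y * y, x * y, y * (x * y), y * (y * (x * y))]

theorem rep_closed {G : Type*} [Group G] (x y : G) (hx : x ^ 2 = 1) (hy : y ^ 3 = 1)
    (h8 : (x * y) ^ 8 = 1) (hr : (y * x) ^ 4 * (y⁻¹ * x) ^ 4 = 1) :
    (y * x) ^ 8 = 1 ∧ ∀ i, (∃ j k, x * cosetRep x y i = cosetRep x y j * (y * x) ^ (k : ℕ)) ∧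
      (∃ j k, y * cosetRep x y i = cosetRep x y j * (y * x) ^ (k : ℕ)) := by
  have hxx : x * x = 1 := by rw [← pow_two, hx]
  have hyyy : y * (y * y) = 1 := by rw [← hy]; simp only [pow_succ, pow_zero, one_mul, mul_assoc, inv_mul_cancel_left, mul_inv_cancel_left, mul_inv_cancel, inv_mul_cancel, mul_one]
  have hxi : x⁻¹ = x := inv_eq_of_mul_eq_one_left hxx
  have hyi : y⁻¹ = y * y := inv_eq_of_mul_eq_one_right hyyy
  have hh8 : (y * x) ^ 8 = 1 := by
    have : (y * x) ^ 8 = x⁻¹ * (x * y) ^ 8 * x := by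
      simp only [pow_succ, pow_zero, one_mul, mul_assoc, inv_mul_cancel_left, mul_inv_cancel_left, mul_inv_cancel, inv_mul_cancel, mul_one]
    rw [this, h8]; group
  obtain ⟨z, hz⟩ : ∃ z, z = (y * x) ^ 4 := ⟨_, rfl⟩
  have hzz : z * z = 1 := by rw [hz, ← pow_add, hh8]
  have hz2 : z = (y⁻¹ * x) ^ 4 := by
    rw [← hz] at hr
    exact mul_left_cancel (hzz.trans hr.symm)
  have c1 : Commute z (y * x) := by rw [hz]; exact (Commute.refl _).pow_left 4
  have c2 : Commute z (y⁻¹ * x) := by rw [hz2]; exact (Commute.refl _).pow_left 4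
  have c3 : Commute z y := by
    have h := (c1.mul_right c2.inv_right)
    have e : y * x * (y⁻¹ * x)⁻¹ = y⁻¹ := by
      rw [mul_inv_rev, hxi, inv_inv, mul_assoc, ← mul_assoc x, hxx, one_mul, hyi]
    rw [e] at h
    simpa using h.inv_right
  have c4 : Commute z x := by
    have h := c3.inv_right.mul_right c1
    rwa [inv_mul_cancel_left] at h
  have h7 : (y * x) ^ 7 = x * (y * y) := by
    rw [← hyi]
    have : (y * x) ^ 7 = (y * x) ^ 8 * (x⁻¹ * y⁻¹) := by
      simp only [pow_succ, pow_zero, one_mul, mul_assoc, inv_mul_cancel_left, mul_inv_cancel_left, mul_inv_cancel, inv_mul_cancel, mul_one]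
    rw [this, hh8, hxi, one_mul]
  have hk : x * (y * (x * y)) = y * (y * (x * y)) * (y * x) ^ 5 := by
    have e5 : (y * x) ^ 5 = y * x * z := by rw [hz]; group
    have e1 : x * (y * (x * y)) = y⁻¹ * (z * (x⁻¹ * y⁻¹ * x⁻¹)) := by
      rw [hz]; simp only [pow_succ, pow_zero, one_mul, mul_assoc, inv_mul_cancel_left, mul_inv_cancel_left, mul_inv_cancel, inv_mul_cancel, mul_one]
    have e2 : z * (x * y⁻¹ * x) = x * y⁻¹ * x * z :=
      ((c4.mul_right c3.inv_right).mul_right c4).eq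
    rw [e1, e5, hxi, e2, hyi]
    simp only [mul_assoc]
  refine ⟨hh8, fun i => ?_⟩
  fin_cases i <;> simp only [cosetRep]
  · exact ⟨⟨2, 1, by simp [← mul_assoc, ← hyi]⟩, ⟨1, 0, by simp⟩⟩
  · exact ⟨⟨3, 0, by simp⟩, ⟨2, 0, by simp⟩⟩
  · exact ⟨⟨0, 7, by simp [h7]⟩, ⟨0, 0, by simp [hyyy]⟩⟩
  · exact ⟨⟨1, 0, by simp [← mul_assoc, hxx]⟩, ⟨4, 0, by simp⟩⟩
  · exact ⟨⟨5, 5, hk⟩, ⟨5, 0, by simp⟩⟩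
  · refine ⟨⟨4, 3, ?_⟩, ⟨3, 0, ?_⟩⟩
    · change x * (y * (y * (x * y))) = y * (x * y) * (y * x) ^ 3
      have : y * (y * (x * y)) = x * (y * (x * y)) * (y * x) ^ 3 := by
        rw [hk, mul_assoc, ← pow_add, hh8, mul_one]
      rw [this, ← mul_assoc, ← mul_assoc x x, hxx, one_mul]
    · change y * (y * (y * (x * y))) = x * y * (y * x) ^ 0
      rw [pow_zero, mul_one, ← mul_assoc y y, ← mul_assoc, mul_assoc y y y, hyyy, one_mul]

theorem GB_form (g : GB) : ∃ (i : Fin 6) (k : Fin 8),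
    g = cosetRep (PresentedGroup.of 0 : GB) (PresentedGroup.of 1) i *
      ((PresentedGroup.of 1 : GB) * PresentedGroup.of 0) ^ (k : ℕ) := by
  have R : ∀ r ∈ relsB, (PresentedGroup.mk relsB r) = 1 :=
    fun r hr => PresentedGroup.one_of_mem hr
  have hx := R _ (Or.inl rfl)
  have hy := R _ (Or.inr (Or.inl rfl))
  have h8 := R _ (Or.inr (Or.inr (Or.inl rfl)))
  have hr := R _ (Or.inr (Or.inr (Or.inr rfl)))
  simp only [map_mul, map_pow, map_inv] at hx hy h8 hr
  obtain ⟨hh8, hc⟩ := rep_closed (PresentedGroup.of 0 : GB) (PresentedGroup.of 1) hx hy h8 hr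
  set x : GB := PresentedGroup.of 0 with hxd
  set y : GB := PresentedGroup.of 1 with hyd
  have hxi : x⁻¹ = x := inv_eq_of_mul_eq_one_left (by rw [← pow_two]; exact hx)
  have hyi : y⁻¹ = y * y := inv_eq_of_mul_eq_one_right (by
    change y ^ 3 = 1 at hy
    rw [← hy, pow_succ, pow_two, mul_assoc])
  suffices h : ∃ (i : Fin 6) (k : ℕ), g = cosetRep x y i * (y * x) ^ k by
    obtain ⟨i, k, rfl⟩ := h
    refine ⟨i, ⟨k % 8, Nat.mod_lt _ (by norm_num)⟩, ?_⟩
    rw [← pow_mod_aux hh8 k]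
  have sx : ∀ g : GB, (∃ (i : Fin 6) (k : ℕ), g = cosetRep x y i * (y * x) ^ k) →
      ∃ (i : Fin 6) (k : ℕ), x * g = cosetRep x y i * (y * x) ^ k := by
    rintro _ ⟨i, k, rfl⟩
    obtain ⟨j, l, h⟩ := (hc i).1
    exact ⟨j, l + k, by rw [← mul_assoc, h, mul_assoc, pow_add]⟩
  have sy : ∀ g : GB, (∃ (i : Fin 6) (k : ℕ), g = cosetRep x y i * (y * x) ^ k) →
      ∃ (i : Fin 6) (k : ℕ), y * g = cosetRep x y i * (y * x) ^ k := by
    rintro _ ⟨i, k, rfl⟩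
    obtain ⟨j, l, h⟩ := (hc i).2
    exact ⟨j, l + k, by rw [← mul_assoc, h, mul_assoc, pow_add]⟩
  have hg : g ∈ Subgroup.closure (Set.range (PresentedGroup.of : Fin 2 → GB)) := by
    rw [PresentedGroup.closure_range_of]; trivial
  induction hg using Subgroup.closure_induction_left with
  | one => exact ⟨0, 0, by simp [cosetRep]⟩
  | mul_left a ha b _ ih =>
    obtain ⟨i, rfl⟩ := ha
    fin_cases i
    · exact sx _ ih
    · exact sy _ ih
  | inv_mul_cancel a ha b _ ih =>
    obtain ⟨i, rfl⟩ := ha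
    fin_cases i
    · change ∃ (i : Fin 6) (k : ℕ), x⁻¹ * b = _
      rw [hxi]; exact sx _ ih
    · change ∃ (i : Fin 6) (k : ℕ), y⁻¹ * b = _
      rw [hyi, mul_assoc]; exact sy _ (sy _ ih)

theorem map_cosetRep {G H : Type*} [Group G] [Group H] (f : G →* H) (x y : G) (i : Fin 6) :
    f (cosetRep x y i) = cosetRep (f x) (f y) i := by
  fin_cases i <;> simp [cosetRep]

set_option maxRecDepth 100000 in
theorem GL_ker : ∀ (i : Fin 6) (k : Fin 8), cosetRep Mx My i * (My * Mx) ^ (k : ℕ) = 1 →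
    i = 0 ∧ k = 0 := by
  decide +kernel

set_option maxRecDepth 100000 in
theorem GL_surj_aux : ∀ a b c d : ZMod 3, a * d - b * c ≠ 0 → ∃ (i : Fin 6) (k : Fin 8),
    (cosetRep Mx My i * (My * Mx) ^ (k : ℕ)).val = !![a, b; c, d] := by
  decide +kernel

theorem GL_rels : ∀ r ∈ relsB, FreeGroup.lift ![Mx, My] r = 1 := by
  rintro r (rfl | rfl | rfl | rfl) <;>
  · simp only [map_mul, map_pow, map_inv, FreeGroup.lift_apply_of, Matrix.cons_val_zero, Matrix.cons_val_one]
    decide +kernel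

open Matrix in
/-- The group `⟨x, y ∣ x² = y³ = (xy)⁸ = (yx)⁴(y⁻¹x)⁴ = 1⟩` is isomorphic to `GL₂(F₃)`,
via an isomorphism sending `x` to `[[0,1],[1,0]]` and `y` to `[[1,1],[0,1]]`. -/
theorem stmt_17 :
    ∃ φ : GB ≃* GL (Fin 2) (ZMod 3),
      φ (PresentedGroup.of 0) = Mx ∧ φ (PresentedGroup.of 1) = My := by
  have key : ∀ g : GB, ∃ (i : Fin 6) (k : Fin 8), g = cosetRep (PresentedGroup.of 0 : GB)
      (PresentedGroup.of 1) i * ((PresentedGroup.of 1 : GB) * PresentedGroup.of 0) ^ (k : ℕ) :=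
    GB_form
  let f : GB →* GL (Fin 2) (ZMod 3) := PresentedGroup.toGroup GL_rels
  have f0 : f (PresentedGroup.of 0) = Mx := PresentedGroup.toGroup.of GL_rels
  have f1 : f (PresentedGroup.of 1) = My := PresentedGroup.toGroup.of GL_rels
  have hf : ∀ (i : Fin 6) (k : Fin 8), f (cosetRep (PresentedGroup.of 0 : GB)
      (PresentedGroup.of 1) i * ((PresentedGroup.of 1 : GB) * PresentedGroup.of 0) ^ (k : ℕ)) =
      cosetRep Mx My i * (My * Mx) ^ (k : ℕ) := by
    intro i k
    rw [map_mul, map_cosetRep, map_pow, map_mul, f0, f1]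
  have inj : Function.Injective f := by
    rw [injective_iff_map_eq_one]
    intro g hg
    obtain ⟨i, k, rfl⟩ := key g
    rw [hf] at hg
    obtain ⟨rfl, rfl⟩ := GL_ker i k hg
    simp [cosetRep]
  have surj : Function.Surjective f := by
    intro M
    have hdet : M.val 0 0 * M.val 1 1 - M.val 0 1 * M.val 1 0 ≠ 0 := by
      rw [← Matrix.det_fin_two]
      exact ((Matrix.isUnit_iff_isUnit_det _).mp M.isUnit).ne_zero
    obtain ⟨i, k, h⟩ := GL_surj_aux _ _ _ _ hdet
    refine ⟨_, (hf i k).trans (Units.ext ?_)⟩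
    rw [h]
    exact (Matrix.eta_fin_two _).symm
  exact ⟨MulEquiv.ofBijective f ⟨inj, surj⟩, f0, f1⟩
end
end
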